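/- (Compactness of sublevel sets.) For every real α, the sublevel set 𝕂_α = { K ∈ 𝕂 : C(K) ≤ α } is a compact subset of the space of tuples of real k×d matrices. -/

import Mathlib

open Matrix Filter
open scoped Kronecker Topology

namespace MJLS

noncomputable section

attribute [local instance] Classical.propDecidable

/-- Closed-loop matrices `Γ i = A i - B i * K i`. -/
def Gam {d k N : ℕ} (A : Fin N → Matrix (Fin d) (Fin d) ℝ)
    (B : Fin N → Matrix (Fin d) (Fin k) ℝ)
    (K : Fin N → Matrix (Fin k) (Fin d) ℝ) : Fin N → Matrix (Fin d) (Fin d) ℝ :=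
  fun i => A i - B i * K i

/-- The operator `E_i(V) = ∑ j, p i j • V j`. -/
def opE {d N : ℕ} (Pr : Matrix (Fin N) (Fin N) ℝ)
    (V : Fin N → Matrix (Fin d) (Fin d) ℝ) : Fin N → Matrix (Fin d) (Fin d) ℝ :=
  fun i => ∑ j, Pr i j • V j

/-- The matrix `𝒜 = diag(Γᵀ ⊗ Γᵀ) (P ⊗ I)`. -/
def calA {d N : ℕ} (Pr : Matrix (Fin N) (Fin N) ℝ)
    (Γ : Fin N → Matrix (Fin d) (Fin d) ℝ) :
    Matrix (Fin N × Fin d × Fin d) (Fin N × Fin d × Fin d) ℝ :=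
  (Matrix.reindex (Equiv.prodComm (Fin d × Fin d) (Fin N))
      (Equiv.prodComm (Fin d × Fin d) (Fin N))
      (Matrix.blockDiagonal fun i => (Γ i)ᵀ ⊗ₖ (Γ i)ᵀ)) *
    (Pr ⊗ₖ (1 : Matrix (Fin d × Fin d) (Fin d × Fin d) ℝ))

/-- `K` is mean-square stabilizing: the spectral radius of `𝒜` is less than `1`. -/
def MSS {d k N : ℕ} (Pr : Matrix (Fin N) (Fin N) ℝ)
    (A : Fin N → Matrix (Fin d) (Fin d) ℝ) (B : Fin N → Matrix (Fin d) (Fin k) ℝ)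
    (K : Fin N → Matrix (Fin k) (Fin d) ℝ) : Prop :=
  spectralRadius ℂ ((calA Pr (Gam A B K)).map (algebraMap ℝ ℂ)) < 1

/-- `P` solves the coupled Lyapunov equations for the policy `K`. -/
def IsLyap {d k N : ℕ} (Pr : Matrix (Fin N) (Fin N) ℝ)
    (A : Fin N → Matrix (Fin d) (Fin d) ℝ) (B : Fin N → Matrix (Fin d) (Fin k) ℝ)
    (Q : Fin N → Matrix (Fin d) (Fin d) ℝ) (R : Fin N → Matrix (Fin k) (Fin k) ℝ)
    (K : Fin N → Matrix (Fin k) (Fin d) ℝ)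
    (P : Fin N → Matrix (Fin d) (Fin d) ℝ) : Prop :=
  ∀ i, P i = Q i + (K i)ᵀ * R i * K i + (Gam A B K i)ᵀ * opE Pr P i * Gam A B K i

/-- `P^K`, the (for mean-square stabilizing `K`, unique) solution of the coupled
Lyapunov equations. -/
def PK {d k N : ℕ} (Pr : Matrix (Fin N) (Fin N) ℝ)
    (A : Fin N → Matrix (Fin d) (Fin d) ℝ) (B : Fin N → Matrix (Fin d) (Fin k) ℝ)
    (Q : Fin N → Matrix (Fin d) (Fin d) ℝ) (R : Fin N → Matrix (Fin k) (Fin k) ℝ)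
    (K : Fin N → Matrix (Fin k) (Fin d) ℝ) : Fin N → Matrix (Fin d) (Fin d) ℝ :=
  if h : ∃ P, IsLyap Pr A B Q R K P then h.choose else 0

/-- The LQR cost `C(K) = ∑ i, π i * tr(P^K_i Sg)`. -/
def cost {d k N : ℕ} (Pr : Matrix (Fin N) (Fin N) ℝ)
    (A : Fin N → Matrix (Fin d) (Fin d) ℝ) (B : Fin N → Matrix (Fin d) (Fin k) ℝ)
    (Q : Fin N → Matrix (Fin d) (Fin d) ℝ) (R : Fin N → Matrix (Fin k) (Fin k) ℝ)
    (piv : Fin N → ℝ) (Sg : Matrix (Fin d) (Fin d) ℝ)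
    (K : Fin N → Matrix (Fin k) (Fin d) ℝ) : ℝ :=
  ∑ i, piv i * (PK Pr A B Q R K i * Sg).trace

/-- The operator `T_j(V) = ∑ i, p i j • (Γ i * V i * Γ iᵀ)`. -/
def opT {d N : ℕ} (Pr : Matrix (Fin N) (Fin N) ℝ)
    (Γ : Fin N → Matrix (Fin d) (Fin d) ℝ)
    (V : Fin N → Matrix (Fin d) (Fin d) ℝ) : Fin N → Matrix (Fin d) (Fin d) ℝ :=
  fun j => ∑ i, Pr i j • (Γ i * V i * (Γ i)ᵀ)

/-- `𝐗^K = ∑_{t=0}^∞ T^t(X(0))` with `X_i(0) = π i • Sg`. -/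
def XK {d N : ℕ} (Pr : Matrix (Fin N) (Fin N) ℝ) (piv : Fin N → ℝ)
    (Sg : Matrix (Fin d) (Fin d) ℝ) (Γ : Fin N → Matrix (Fin d) (Fin d) ℝ) :
    Fin N → Matrix (Fin d) (Fin d) ℝ :=
  ∑' t : ℕ, (opT Pr Γ)^[t] (fun i => piv i • Sg)

/-- `L^K_i = (R i + B iᵀ E_i(P^K) B i) K i - B iᵀ E_i(P^K) A i`. -/
def LK {d k N : ℕ} (Pr : Matrix (Fin N) (Fin N) ℝ)
    (A : Fin N → Matrix (Fin d) (Fin d) ℝ) (B : Fin N → Matrix (Fin d) (Fin k) ℝ)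
    (Q : Fin N → Matrix (Fin d) (Fin d) ℝ) (R : Fin N → Matrix (Fin k) (Fin k) ℝ)
    (K : Fin N → Matrix (Fin k) (Fin d) ℝ) : Fin N → Matrix (Fin k) (Fin d) ℝ :=
  fun i => (R i + (B i)ᵀ * opE Pr (PK Pr A B Q R K) i * B i) * K i
    - (B i)ᵀ * opE Pr (PK Pr A B Q R K) i * A i

/-- The operator `L_i(V) = Γ iᵀ E_i(V) Γ i`. -/
def opL {d N : ℕ} (Pr : Matrix (Fin N) (Fin N) ℝ)
    (Γ : Fin N → Matrix (Fin d) (Fin d) ℝ)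
    (V : Fin N → Matrix (Fin d) (Fin d) ℝ) : Fin N → Matrix (Fin d) (Fin d) ℝ :=
  fun i => (Γ i)ᵀ * opE Pr V i * Γ i

/-- `(P^K)'[E] = ∑_{t=0}^∞ L^t(Eᵀ L^K + (L^K)ᵀ E)`. -/
def PKd {d k N : ℕ} (Pr : Matrix (Fin N) (Fin N) ℝ)
    (Γ : Fin N → Matrix (Fin d) (Fin d) ℝ)
    (Lk E : Fin N → Matrix (Fin k) (Fin d) ℝ) : Fin N → Matrix (Fin d) (Fin d) ℝ :=
  ∑' t : ℕ, (opL Pr Γ)^[t] (fun i => (E i)ᵀ * Lk i + (Lk i)ᵀ * E i)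

/-- `‖V‖₂² = ∑ i, tr(V iᵀ V i)`. -/
def norm2sq {a b N : ℕ} (V : Fin N → Matrix (Fin a) (Fin b) ℝ) : ℝ :=
  ∑ i, ((V i)ᵀ * V i).trace

/-- The inner product `⟨V, S⟩ = ∑ i, tr(V iᵀ S i)`. -/
def ip {a b N : ℕ} (V S : Fin N → Matrix (Fin a) (Fin b) ℝ) : ℝ :=
  ∑ i, ((V i)ᵀ * S i).trace

/-- The spectral norm (maximal singular value) of a matrix. -/
def specNorm {a b : ℕ} (M : Matrix (Fin a) (Fin b) ℝ) : ℝ :=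
  ⨆ x : {x : EuclideanSpace ℝ (Fin b) // ‖x‖ ≤ 1}, ‖Matrix.toEuclideanLin M x.1‖

/-- The minimal singular value of a square matrix. -/
def sigmaMin {a : ℕ} (M : Matrix (Fin a) (Fin a) ℝ) : ℝ :=
  ⨅ x : {x : EuclideanSpace ℝ (Fin a) // ‖x‖ = 1}, ‖Matrix.toEuclideanLin M x.1‖

/-- `‖V‖_max = max_i ‖V i‖` (spectral norms). -/
def maxNorm {a b N : ℕ} (V : Fin N → Matrix (Fin a) (Fin b) ℝ) : ℝ :=
  ⨆ i, specNorm (V i)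

/-- `Λ_min(V) = min_i σ_min(V i)`. -/
def lamMin {a N : ℕ} (V : Fin N → Matrix (Fin a) (Fin a) ℝ) : ℝ :=
  ⨅ i, sigmaMin (V i)

/-- `μ = (min_i π i) · σ_min(Sg)`. -/
def mu {d N : ℕ} (piv : Fin N → ℝ) (Sg : Matrix (Fin d) (Fin d) ℝ) : ℝ :=
  (⨅ i, piv i) * sigmaMin Sg

/-- `ξ(α) = (1/Λ_min(Q))·((1 + ‖B‖²_max)·α/μ + ‖R‖_max) − 1`. -/
def xi {d k N : ℕ} (B : Fin N → Matrix (Fin d) (Fin k) ℝ)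
    (R : Fin N → Matrix (Fin k) (Fin k) ℝ) (Q : Fin N → Matrix (Fin d) (Fin d) ℝ)
    (piv : Fin N → ℝ) (Sg : Matrix (Fin d) (Fin d) ℝ) (α : ℝ) : ℝ :=
  (1 / lamMin Q) * ((1 + maxNorm B ^ 2) * α / mu piv Sg + maxNorm R) - 1

/-- The smoothness constant
`L(α) = 2·(‖R‖_max + ‖B‖²_max·(1 + 2ξ(α)/‖B‖_max)·α/μ)·α/Λ_min(Q)`. -/
def Lsm {d k N : ℕ} (B : Fin N → Matrix (Fin d) (Fin k) ℝ)
    (R : Fin N → Matrix (Fin k) (Fin k) ℝ) (Q : Fin N → Matrix (Fin d) (Fin d) ℝ)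
    (piv : Fin N → ℝ) (Sg : Matrix (Fin d) (Fin d) ℝ) (α : ℝ) : ℝ :=
  2 * (maxNorm R + maxNorm B ^ 2 * (1 + 2 * xi B R Q piv Sg α / maxNorm B)
      * α / mu piv Sg) * α / lamMin Q

end


lemma iter_mulVec {n : Type*} [Fintype n] [DecidableEq n] (M : Matrix n n ℝ) (t : ℕ) (v : n → ℝ) :
    (fun w => M *ᵥ w)^[t] v = (M ^ t) *ᵥ v := by
  induction t with
  | zero => simp
  | succ t ih => rw [Function.iterate_succ_apply', ih, pow_succ', Matrix.mulVec_mulVec]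

section
attribute [local instance] Matrix.linftyOpNormedRing Matrix.linftyOpNormedAlgebra

lemma entry_le {n : Type*} [Fintype n] [DecidableEq n] (M : Matrix n n ℂ) (i j : n) :
    ‖M i j‖₊ ≤ ‖M‖₊ := by
  rw [Matrix.linfty_opNNNorm_def]
  refine le_trans ?_ (Finset.le_sup (f := fun i => ∑ j, ‖M i j‖₊) (Finset.mem_univ i))
  exact Finset.single_le_sum (f := fun j => ‖M i j‖₊) (fun _ _ => zero_le) (Finset.mem_univ j)

lemma pow_entry_tendsto {n : Type*} [Fintype n] [DecidableEq n] (M : Matrix n n ℂ)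
    (h : spectralRadius ℂ M < 1) (i j : n) :
    Tendsto (fun t : ℕ => (M ^ t) i j) atTop (𝓝 0) := by
  obtain ⟨r, hr, hr1⟩ := ENNReal.lt_iff_exists_nnreal_btwn.1 h
  have hr1' : r < 1 := by exact_mod_cast hr1
  have hg := spectrum.pow_nnnorm_pow_one_div_tendsto_nhds_spectralRadius M
  have hev := hg.eventually_lt_const hr
  have hz : Tendsto (fun t : ℕ => ((r : ℝ)) ^ t) atTop (𝓝 0) :=
    tendsto_pow_atTop_nhds_zero_of_lt_one r.2 (by exact_mod_cast hr1')
  refine squeeze_zero_norm' ?_ hz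
  filter_upwards [hev, eventually_gt_atTop 0] with t ht ht0
  have h1 : (‖M ^ t‖₊ : ENNReal) ≤ (r : ENNReal) ^ t := by
    have := ENNReal.rpow_le_rpow ht.le (Nat.cast_nonneg t)
    rw [← ENNReal.rpow_mul, one_div, inv_mul_cancel₀ (by positivity), ENNReal.rpow_one,
      ENNReal.rpow_natCast] at this
    exact this
  have h2 : ‖M ^ t‖₊ ≤ r ^ t := by exact_mod_cast h1
  exact_mod_cast (entry_le (M ^ t) i j).trans h2

lemma specRad_lt {n : Type*} [Fintype n] [DecidableEq n] [Nonempty n] (M : Matrix n n ℂ)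
    (h : ∀ z ∈ spectrum ℂ M, ‖z‖ < 1) : spectralRadius ℂ M < 1 := by
  have := spectrum.spectralRadius_lt_of_forall_lt (r := 1) M (fun z hz => by exact_mod_cast h z hz)
  simpa using this
end

lemma map_pow_entry {n : Type*} [Fintype n] [DecidableEq n] (M : Matrix n n ℝ) (t : ℕ) (i j : n) :
    ((M.map (algebraMap ℝ ℂ)) ^ t) i j = (((M ^ t) i j : ℝ) : ℂ) := by
  have := map_pow ((algebraMap ℝ ℂ).mapMatrix (m := n)) M t
  have h2 := congrFun (congrFun this i) j
  simpa using h2.symm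

lemma iter_tendsto_of_specRad {n : Type*} [Fintype n] [DecidableEq n] (M : Matrix n n ℝ)
    (h : spectralRadius ℂ (M.map (algebraMap ℝ ℂ)) < 1) (v : n → ℝ) (i : n) :
    Tendsto (fun t : ℕ => (fun w => M *ᵥ w)^[t] v i) atTop (𝓝 0) := by
  simp only [iter_mulVec, mulVec, dotProduct]
  have : (0 : ℝ) = ∑ j, 0 * v j := by simp
  rw [this]
  refine tendsto_finsetSum _ fun j _ => Tendsto.mul_const _ ?_
  have := pow_entry_tendsto _ h i j
  simp only [map_pow_entry] at this
  simpa [Function.comp_def] using (Complex.continuous_re.tendsto 0).comp this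

lemma specRad_of_iter_tendsto {n : Type*} [Fintype n] [DecidableEq n] [Nonempty n]
    (M : Matrix n n ℝ)
    (h : ∀ (v : n → ℝ) (i : n), Tendsto (fun t : ℕ => (fun w => M *ᵥ w)^[t] v i) atTop (𝓝 0)) :
    spectralRadius ℂ (M.map (algebraMap ℝ ℂ)) < 1 := by
  have hent : ∀ i j, Tendsto (fun t : ℕ => ((M.map (algebraMap ℝ ℂ)) ^ t) i j) atTop (𝓝 0) := by
    intro i j
    have := h (Pi.single j 1) i
    simp only [iter_mulVec, mulVec_single_one, col_apply] at this
    simp only [map_pow_entry]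
    simpa [Function.comp_def] using (Complex.continuous_ofReal.tendsto 0).comp this
  apply specRad_lt
  intro z hz
  set C := M.map (algebraMap ℝ ℂ) with hC
  rw [spectrum.mem_iff, Matrix.isUnit_iff_isUnit_det, isUnit_iff_ne_zero, not_not,
    ← Matrix.exists_mulVec_eq_zero_iff] at hz
  obtain ⟨v, hv, hzv⟩ := hz
  have hCv : C *ᵥ v = z • v := by
    rw [sub_mulVec, sub_eq_zero] at hzv
    rw [← hzv, Algebra.algebraMap_eq_smul_one, smul_mulVec, one_mulVec]
  have hpow : ∀ t : ℕ, (C ^ t) *ᵥ v = z ^ t • v := by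
    intro t
    induction t with
    | zero => simp
    | succ t ih => rw [pow_succ', ← Matrix.mulVec_mulVec, ih, mulVec_smul, hCv, smul_smul, pow_succ]
  obtain ⟨i, hi⟩ := Function.ne_iff.1 hv
  have ht : Tendsto (fun t : ℕ => ((C ^ t) *ᵥ v) i) atTop (𝓝 0) := by
    simp only [mulVec, dotProduct]
    have : (0 : ℂ) = ∑ j, 0 * v j := by simp
    rw [this]
    exact tendsto_finsetSum _ fun j _ => Tendsto.mul_const _ (hent i j)
  simp only [hpow, Pi.smul_apply, smul_eq_mul] at ht
  have ht2 := ht.mul_const (v i)⁻¹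
  simp only [mul_assoc, mul_inv_cancel₀ (show v i ≠ 0 from hi), mul_one, zero_mul] at ht2
  exact tendsto_pow_atTop_nhds_zero_iff_norm_lt_one.1 ht2

lemma opL_bil {d N : ℕ} (Pr : Matrix (Fin N) (Fin N) ℝ) (Γ V : Fin N → Matrix (Fin d) (Fin d) ℝ)
    (i : Fin N) (x y : Fin d → ℝ) :
    x ⬝ᵥ (opL Pr Γ V i *ᵥ y)
      = ∑ j, Pr i j * ((Γ i *ᵥ x) ⬝ᵥ (V j *ᵥ (Γ i *ᵥ y))) := by
  have h1 : x ⬝ᵥ (opL Pr Γ V i *ᵥ y) = (Γ i *ᵥ x) ⬝ᵥ (opE Pr V i *ᵥ (Γ i *ᵥ y)) := by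
    unfold opL
    rw [← Matrix.mulVec_mulVec, ← Matrix.mulVec_mulVec, Matrix.dotProduct_mulVec,
      Matrix.vecMul_transpose]
  rw [h1]
  unfold opE
  rw [Matrix.sum_mulVec, dotProduct_sum]
  refine Finset.sum_congr rfl fun j _ => ?_
  rw [Matrix.smul_mulVec, dotProduct_smul, smul_eq_mul]

lemma calA_apply {d N : ℕ} (Pr : Matrix (Fin N) (Fin N) ℝ)
    (Γ : Fin N → Matrix (Fin d) (Fin d) ℝ) (p q : Fin N × Fin d × Fin d) :
    calA Pr Γ p q = Pr p.1 q.1 * (Γ p.1 q.2.1 p.2.1 * Γ p.1 q.2.2 p.2.2) := by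
  obtain ⟨i, a, b⟩ := p
  obtain ⟨j, c, e⟩ := q
  unfold calA
  rw [Matrix.mul_apply, Fintype.sum_eq_single (i, c, e)]
  · simp [Matrix.blockDiagonal_apply, Matrix.kroneckerMap_apply]
    ring
  · rintro ⟨j', c', e'⟩ h
    by_cases hj : i = j'
    · subst hj
      have : (c', e') ≠ (c, e) := fun h' => h (by rw [h'])
      simp [this, Matrix.kroneckerMap_apply]
    · simp [Matrix.blockDiagonal_apply, hj]

lemma calA_mulVec {d N : ℕ} (Pr : Matrix (Fin N) (Fin N) ℝ)
    (Γ V : Fin N → Matrix (Fin d) (Fin d) ℝ) :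
    calA Pr Γ *ᵥ (fun q => V q.1 q.2.1 q.2.2) = fun q => opL Pr Γ V q.1 q.2.1 q.2.2 := by
  ext ⟨i, a, b⟩
  have h := opL_bil Pr Γ V i (Pi.single a 1) (Pi.single b 1)
  rw [mulVec_single_one, single_one_dotProduct, mulVec_single_one, mulVec_single_one] at h
  simp only [col_apply] at h
  rw [h]
  simp only [mulVec, dotProduct, calA_apply, Fintype.sum_prod_type, col_apply, Finset.mul_sum]
  refine Finset.sum_congr rfl fun j _ => Finset.sum_congr rfl fun c _ =>
    Finset.sum_congr rfl fun e _ => ?_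
  ring

lemma calA_iter {d N : ℕ} (Pr : Matrix (Fin N) (Fin N) ℝ)
    (Γ V : Fin N → Matrix (Fin d) (Fin d) ℝ) (t : ℕ) :
    (fun w => calA Pr Γ *ᵥ w)^[t] (fun q => V q.1 q.2.1 q.2.2)
      = fun q => (opL Pr Γ)^[t] V q.1 q.2.1 q.2.2 := by
  induction t with
  | zero => rfl
  | succ t ih => rw [Function.iterate_succ_apply', ih, calA_mulVec, Function.iterate_succ_apply']

lemma MSS_iff {d k N : ℕ} (hd : 0 < d) (hN : 0 < N) (Pr : Matrix (Fin N) (Fin N) ℝ)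
    (A : Fin N → Matrix (Fin d) (Fin d) ℝ) (B : Fin N → Matrix (Fin d) (Fin k) ℝ)
    (K : Fin N → Matrix (Fin k) (Fin d) ℝ) :
    MSS Pr A B K ↔ ∀ (V : Fin N → Matrix (Fin d) (Fin d) ℝ) i a b,
      Tendsto (fun t : ℕ => (opL Pr (Gam A B K))^[t] V i a b) atTop (𝓝 0) := by
  constructor
  · intro h V i a b
    have := iter_tendsto_of_specRad _ h (fun q => V q.1 q.2.1 q.2.2) (i, a, b)
    simpa only [calA_iter] using this
  · intro h
    have : Nonempty (Fin N × Fin d × Fin d) := ⟨(⟨0, hN⟩, ⟨0, hd⟩, ⟨0, hd⟩)⟩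
    apply specRad_of_iter_tendsto
    rintro v ⟨i, a, b⟩
    have := h (fun i => Matrix.of fun a b => v (i, a, b)) i a b
    have h2 := fun t => calA_iter Pr (Gam A B K) (fun i => Matrix.of fun a b => v (i, a, b)) t
    simp only [of_apply] at h2
    simp only [Prod.mk.eta] at h2
    simp only [h2]
    exact this

/-- Symmetric positive semidefinite real matrices. -/
def SPsd {d : ℕ} (M : Matrix (Fin d) (Fin d) ℝ) : Prop :=
  Mᵀ = M ∧ ∀ x : Fin d → ℝ, 0 ≤ x ⬝ᵥ (M *ᵥ x)

lemma SPsd.posSemidef {d : ℕ} {M : Matrix (Fin d) (Fin d) ℝ} (h : SPsd M) : M.PosSemidef :=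
  Matrix.PosSemidef.of_dotProduct_mulVec_nonneg
    (by rw [Matrix.IsHermitian, conjTranspose_eq_transpose_of_trivial]; exact h.1)
    (by intro x; simpa using h.2 x)

lemma SPsd.of {d : ℕ} {M : Matrix (Fin d) (Fin d) ℝ} (h : M.PosSemidef) : SPsd M :=
  ⟨by simpa [Matrix.IsHermitian, conjTranspose_eq_transpose_of_trivial] using h.1,
    fun x => by simpa using h.dotProduct_mulVec_nonneg x⟩

lemma isClosed_SPsd {d : ℕ} : IsClosed {M : Matrix (Fin d) (Fin d) ℝ | SPsd M} := by
  unfold SPsd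
  simp only [Set.ofPred_and, Set.ofPred_forall]
  refine IsClosed.inter (isClosed_eq (by fun_prop) (by fun_prop)) ?_
  exact isClosed_iInter fun x => isClosed_le (by fun_prop) (by fun_prop)

lemma SPsd.add {d : ℕ} {M M' : Matrix (Fin d) (Fin d) ℝ} (h : SPsd M) (h' : SPsd M') :
    SPsd (M + M') := SPsd.of (h.posSemidef.add h'.posSemidef)

lemma SPsd_opL {d N : ℕ} (Pr : Matrix (Fin N) (Fin N) ℝ) (hPr : ∀ i j, 0 ≤ Pr i j)
    (Γ V : Fin N → Matrix (Fin d) (Fin d) ℝ) (hV : ∀ i, SPsd (V i)) (i : Fin N) :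
    SPsd (opL Pr Γ V i) := by
  constructor
  · unfold opL opE
    simp only [transpose_mul, transpose_transpose, transpose_sum, transpose_smul, (hV _).1,
      Matrix.mul_assoc]
  · intro x
    rw [opL_bil]
    exact Finset.sum_nonneg fun j _ => mul_nonneg (hPr i j) ((hV j).2 _)

lemma PosDef_lower {d : ℕ} {M : Matrix (Fin d) (Fin d) ℝ} (h : M.PosDef) :
    ∃ δ > 0, ∀ x : Fin d → ℝ, δ * (x ⬝ᵥ x) ≤ x ⬝ᵥ (M *ᵥ x) := by
  have hpos : ∀ x : Fin d → ℝ, x ≠ 0 → 0 < x ⬝ᵥ (M *ᵥ x) := fun x hx => by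
    simpa using h.dotProduct_mulVec_pos hx
  have hcont : Continuous fun x : Fin d → ℝ => x ⬝ᵥ (M *ᵥ x) := by fun_prop
  have hcont1 : Continuous fun x : Fin d → ℝ => x ⬝ᵥ x := by fun_prop
  rcases (Metric.sphere (0 : Fin d → ℝ) 1).eq_empty_or_nonempty with he | hne
  · refine ⟨1, one_pos, fun x => ?_⟩
    have : x = 0 := by
      by_contra hx
      have : (‖x‖⁻¹ • x) ∈ Metric.sphere (0 : Fin d → ℝ) 1 := by
        simp [norm_smul, inv_mul_cancel₀ (norm_ne_zero_iff.2 hx)]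
      rw [he] at this
      exact this
    simp [this]
  · have hx0 : ∀ x ∈ Metric.sphere (0 : Fin d → ℝ) 1, x ≠ 0 := by
      rintro x hx rfl
      simp at hx
    have hxx : ∀ x : Fin d → ℝ, x ≠ 0 → 0 < x ⬝ᵥ x := fun x hx => by
      have := dotProduct_star_self_pos_iff.2 hx
      simpa using this
    obtain ⟨z, hz, hmin⟩ := (isCompact_sphere (0 : Fin d → ℝ) 1).exists_isMinOn hne
      (f := fun x => (x ⬝ᵥ (M *ᵥ x)) / (x ⬝ᵥ x))
      (ContinuousOn.div hcont.continuousOn hcont1.continuousOn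
        fun x hx => (hxx x (hx0 x hx)).ne')
    refine ⟨_, div_pos (hpos z (hx0 z hz)) (hxx z (hx0 z hz)), fun x => ?_⟩
    by_cases hx : x = 0
    · simp [hx]
    have hn : ‖x‖ ≠ 0 := norm_ne_zero_iff.2 hx
    have hm : (‖x‖⁻¹ • x) ∈ Metric.sphere (0 : Fin d → ℝ) 1 := by
      simp [norm_smul, inv_mul_cancel₀ hn]
    have h1 := hmin hm
    simp only [Set.mem_ofPred_eq] at h1
    rw [le_div_iff₀ (hxx _ (hx0 _ hm))] at h1
    simp only [mulVec_smul, dotProduct_smul, smul_dotProduct, smul_eq_mul] at h1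
    have h2 : (0 : ℝ) < ‖x‖⁻¹ * ‖x‖⁻¹ := by positivity
    refine le_of_mul_le_mul_left ?_ h2
    linarith

lemma bil_upper {d : ℕ} (V : Matrix (Fin d) (Fin d) ℝ) :
    ∃ c : ℝ, 0 ≤ c ∧ ∀ x y : Fin d → ℝ, |x ⬝ᵥ (V *ᵥ y)| ≤ c * (x ⬝ᵥ x + y ⬝ᵥ y) := by
  refine ⟨∑ a, ∑ b, |V a b|, Finset.sum_nonneg fun _ _ => Finset.sum_nonneg fun _ _ => abs_nonneg _,
    fun x y => ?_⟩
  have hs : ∀ (x : Fin d → ℝ) a, x a * x a ≤ x ⬝ᵥ x := fun x a =>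
    Finset.single_le_sum (f := fun a => x a * x a) (fun a _ => mul_self_nonneg _) (Finset.mem_univ a)
  simp only [mulVec, dotProduct, Finset.mul_sum, Finset.sum_mul]
  refine (Finset.abs_sum_le_sum_abs _ _).trans (Finset.sum_le_sum fun a _ => ?_)
  refine (Finset.abs_sum_le_sum_abs _ _).trans (Finset.sum_le_sum fun b _ => ?_)
  have h1 := hs x a
  have h2 := hs y b
  simp only [dotProduct] at h1 h2
  have h3 : |x a * y b| ≤ x a * x a + y b * y b := by
    rw [abs_le]; constructor <;> nlinarith [sq_nonneg (x a + y b), sq_nonneg (x a - y b),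
      sq_nonneg (x a), sq_nonneg (y b)]
  calc |x a * (V a b * y b)| = |V a b| * |x a * y b| := by rw [← abs_mul]; ring_nf
    _ ≤ |V a b| * _ := mul_le_mul_of_nonneg_left (h3.trans (add_le_add h1 h2)) (abs_nonneg _)

lemma trace_lower {d : ℕ} {P S : Matrix (Fin d) (Fin d) ℝ} (hP : SPsd P) {δ : ℝ}
    (hS : ∀ x : Fin d → ℝ, δ * (x ⬝ᵥ x) ≤ x ⬝ᵥ (S *ᵥ x)) :
    δ * P.trace ≤ (P * S).trace := by
  obtain ⟨m, v, hv⟩ := Matrix.posSemidef_iff_eq_sum_vecMulVec.1 hP.posSemidef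
  have hv' : P = ∑ i, vecMulVec (v i) (v i) := by simpa using hv
  rw [hv', trace_sum, Finset.sum_mul, trace_sum, Finset.mul_sum]
  refine Finset.sum_le_sum fun i _ => ?_
  have h := hS (v i)
  rw [trace_vecMulVec, vecMulVec_mul, trace_vecMulVec, dotProduct_comm (v i) (v i ᵥ* S),
    ← dotProduct_mulVec]
  exact h

lemma opL_sub {d N : ℕ} (Pr : Matrix (Fin N) (Fin N) ℝ) (Γ V W : Fin N → Matrix (Fin d) (Fin d) ℝ) :
    opL Pr Γ (V - W) = opL Pr Γ V - opL Pr Γ W := by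
  funext i
  simp [opL, opE, smul_sub, Finset.sum_sub_distrib, Matrix.mul_sub, Matrix.sub_mul]

/-- The operator `opL` as a linear map. -/
def opLlin {d N : ℕ} (Pr : Matrix (Fin N) (Fin N) ℝ) (Γ : Fin N → Matrix (Fin d) (Fin d) ℝ) :
    (Fin N → Matrix (Fin d) (Fin d) ℝ) →ₗ[ℝ] (Fin N → Matrix (Fin d) (Fin d) ℝ) where
  toFun := opL Pr Γ
  map_add' V W := by
    funext i
    simp [opL, opE, smul_add, Finset.sum_add_distrib, Matrix.mul_add, Matrix.add_mul]
  map_smul' c V := by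
    funext i
    simp [opL, opE, smul_comm _ c, ← Finset.smul_sum]

lemma fixed_zero {d N : ℕ} (Pr : Matrix (Fin N) (Fin N) ℝ)
    (Γ D : Fin N → Matrix (Fin d) (Fin d) ℝ)
    (h : ∀ (V : Fin N → Matrix (Fin d) (Fin d) ℝ) i a b,
      Tendsto (fun t : ℕ => (opL Pr Γ)^[t] V i a b) atTop (𝓝 0))
    (hD : opL Pr Γ D = D) : D = 0 := by
  funext i
  ext a b
  have := h D i a b
  simp only [Function.iterate_fixed hD] at this
  exact tendsto_nhds_unique tendsto_const_nhds this

section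
variable {d k N : ℕ} {Pr : Matrix (Fin N) (Fin N) ℝ}
    {A : Fin N → Matrix (Fin d) (Fin d) ℝ} {B : Fin N → Matrix (Fin d) (Fin k) ℝ}
    {Q : Fin N → Matrix (Fin d) (Fin d) ℝ} {R : Fin N → Matrix (Fin k) (Fin k) ℝ}
    {K : Fin N → Matrix (Fin k) (Fin d) ℝ} {P P' : Fin N → Matrix (Fin d) (Fin d) ℝ}

lemma lyap_unique
    (h : ∀ (V : Fin N → Matrix (Fin d) (Fin d) ℝ) i a b,
      Tendsto (fun t : ℕ => (opL Pr (Gam A B K))^[t] V i a b) atTop (𝓝 0))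
    (h1 : IsLyap Pr A B Q R K P) (h2 : IsLyap Pr A B Q R K P') : P = P' := by
  refine sub_eq_zero.1 (fixed_zero Pr _ _ h ?_)
  rw [opL_sub]
  funext i
  have e1 := h1 i
  have e2 := h2 i
  change P i = _ + opL Pr (Gam A B K) P i at e1
  change P' i = _ + opL Pr (Gam A B K) P' i at e2
  simp only [Pi.sub_apply]
  generalize opL Pr (Gam A B K) P i = X at *
  generalize opL Pr (Gam A B K) P' i = Y at *
  rw [e1, e2]
  abel

lemma lyap_exists
    (h : ∀ (V : Fin N → Matrix (Fin d) (Fin d) ℝ) i a b,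
      Tendsto (fun t : ℕ => (opL Pr (Gam A B K))^[t] V i a b) atTop (𝓝 0)) :
    ∃ P, IsLyap Pr A B Q R K P := by
  have hinj : Function.Injective
      ((LinearMap.id - opLlin Pr (Gam A B K) :
        (Fin N → Matrix (Fin d) (Fin d) ℝ) →ₗ[ℝ] (Fin N → Matrix (Fin d) (Fin d) ℝ))) := by
    rw [← LinearMap.ker_eq_bot, LinearMap.ker_eq_bot']
    intro D hD
    refine fixed_zero Pr _ _ h ?_
    exact (sub_eq_zero.1 hD).symm
  obtain ⟨P, hP⟩ := LinearMap.injective_iff_surjective.1 hinj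
    (fun i => Q i + (K i)ᵀ * R i * K i)
  refine ⟨P, fun i => ?_⟩
  have := congrFun hP i
  change P i - opL Pr (Gam A B K) P i = _ at this
  exact sub_eq_iff_eq_add.1 this

lemma KRK_quad (M : Matrix (Fin k) (Fin k) ℝ) (L : Matrix (Fin k) (Fin d) ℝ) (x : Fin d → ℝ) :
    x ⬝ᵥ ((Lᵀ * M * L) *ᵥ x) = (L *ᵥ x) ⬝ᵥ (M *ᵥ (L *ᵥ x)) := by
  rw [← Matrix.mulVec_mulVec, ← Matrix.mulVec_mulVec, Matrix.dotProduct_mulVec,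
      Matrix.vecMul_transpose]

lemma SPsd_stage (hQ : ∀ i, (Q i).PosDef) (hR : ∀ i, (R i).PosDef) (i : Fin N) :
    SPsd (Q i + (K i)ᵀ * R i * K i) := by
  refine (SPsd.of (hQ i).posSemidef).add ?_
  have := (hR i).posSemidef.conjTranspose_mul_mul_same (K i)
  rw [conjTranspose_eq_transpose_of_trivial] at this
  exact SPsd.of this

lemma lyap_psd (hPr : ∀ i j, 0 ≤ Pr i j) (hQ : ∀ i, (Q i).PosDef) (hR : ∀ i, (R i).PosDef)
    (h : ∀ (V : Fin N → Matrix (Fin d) (Fin d) ℝ) i a b,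
      Tendsto (fun t : ℕ => (opL Pr (Gam A B K))^[t] V i a b) atTop (𝓝 0))
    (h1 : IsLyap Pr A B Q R K P) (i : Fin N) : SPsd (P i) := by
  have hs : ∀ t : ℕ, ∀ i, SPsd ((P - (opL Pr (Gam A B K))^[t] P) i) := by
    intro t
    induction t with
    | zero => intro i; simpa using SPsd.of Matrix.PosSemidef.zero
    | succ t ih =>
      intro i
      have e : (P - (opL Pr (Gam A B K))^[t+1] P) i = (Q i + (K i)ᵀ * R i * K i)
          + opL Pr (Gam A B K) (P - (opL Pr (Gam A B K))^[t] P) i := by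
        rw [Function.iterate_succ_apply', opL_sub]
        have e1 := h1 i
        change P i = _ + opL Pr (Gam A B K) P i at e1
        simp only [Pi.sub_apply]
        nth_rewrite 1 [e1]
        abel
      rw [e]
      exact (SPsd_stage hQ hR i).add (SPsd_opL Pr hPr _ _ ih i)
  change P i ∈ {M | SPsd M}
  refine isClosed_SPsd.mem_of_tendsto (b := atTop)
    (f := fun t : ℕ => (P - (opL Pr (Gam A B K))^[t] P) i) ?_ (Eventually.of_forall fun t => hs t i)
  refine tendsto_pi_nhds.2 fun a => tendsto_pi_nhds.2 fun b => ?_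
  have := (tendsto_const_nhds (x := P i a b)).sub (h P i a b)
  simpa using this

lemma lyap_lower (hPr : ∀ i j, 0 ≤ Pr i j) (hP : ∀ i, SPsd (P i))
    (h1 : IsLyap Pr A B Q R K P) (i : Fin N) (x : Fin d → ℝ) :
    x ⬝ᵥ (Q i *ᵥ x) + (K i *ᵥ x) ⬝ᵥ (R i *ᵥ (K i *ᵥ x)) ≤ x ⬝ᵥ (P i *ᵥ x) := by
  have e1 := h1 i
  change P i = _ + opL Pr (Gam A B K) P i at e1
  have h2 := (SPsd_opL Pr hPr (Gam A B K) P hP i).2 x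
  rw [e1, add_mulVec, add_mulVec, dotProduct_add, dotProduct_add, KRK_quad]
  linarith

lemma lyap_stable (hPr : ∀ i j, 0 ≤ Pr i j) (hQ : ∀ i, (Q i).PosDef) (hR : ∀ i, (R i).PosDef)
    (hP : ∀ i, SPsd (P i)) (h1 : IsLyap Pr A B Q R K P)
    (V : Fin N → Matrix (Fin d) (Fin d) ℝ) (i : Fin N) (a b : Fin d) :
    Tendsto (fun t : ℕ => (opL Pr (Gam A B K))^[t] V i a b) atTop (𝓝 0) := by
  choose δ hδ hδQ using fun i => PosDef_lower (hQ i)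
  choose cP hcP hcP' using fun i => bil_upper (P i)
  choose cV hcV hcV' using fun i => bil_upper (V i)
  have hxx : ∀ x : Fin d → ℝ, 0 ≤ x ⬝ᵥ x := fun x =>
    Finset.sum_nonneg fun a _ => mul_self_nonneg (x a)
  have hRn : ∀ i (x : Fin k → ℝ), 0 ≤ x ⬝ᵥ (R i *ᵥ x) := fun i => (SPsd.of (hR i).posSemidef).2
  have hQP : ∀ i x, x ⬝ᵥ (Q i *ᵥ x) ≤ x ⬝ᵥ (P i *ᵥ x) := fun i x => by
    have := lyap_lower hPr hP h1 i x
    have := hRn i (K i *ᵥ x)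
    linarith
  -- `V` is bounded by `c • P`
  set c : ℝ := ∑ i, cV i / δ i with hc
  have hc0 : 0 ≤ c := Finset.sum_nonneg fun i _ => div_nonneg (hcV i) (hδ i).le
  have hVc : ∀ i (x y : Fin d → ℝ),
      |x ⬝ᵥ (V i *ᵥ y)| ≤ c * (x ⬝ᵥ (P i *ᵥ x) + y ⬝ᵥ (P i *ᵥ y)) := by
    intro i x y
    have hle : cV i / δ i ≤ c := Finset.single_le_sum (f := fun i => cV i / δ i)
      (fun i _ => div_nonneg (hcV i) (hδ i).le) (Finset.mem_univ i)
    have hx := (hδQ i x).trans (hQP i x)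
    have hy := (hδQ i y).trans (hQP i y)
    have hnn : 0 ≤ x ⬝ᵥ (P i *ᵥ x) + y ⬝ᵥ (P i *ᵥ y) := add_nonneg ((hP i).2 x) ((hP i).2 y)
    calc _ ≤ cV i * (x ⬝ᵥ x + y ⬝ᵥ y) := hcV' i x y
      _ = (cV i / δ i) * (δ i * (x ⬝ᵥ x) + δ i * (y ⬝ᵥ y)) := by
        have := (hδ i).ne'
        field_simp
      _ ≤ (cV i / δ i) * (x ⬝ᵥ (P i *ᵥ x) + y ⬝ᵥ (P i *ᵥ y)) :=
        mul_le_mul_of_nonneg_left (add_le_add hx hy) (div_nonneg (hcV i) (hδ i).le)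
      _ ≤ _ := mul_le_mul_of_nonneg_right hle hnn
  clear_value c
  -- contraction factor
  set C : ℝ := 1 + ∑ i, 2 * cP i / δ i with hC
  have hC1 : 1 ≤ C := le_add_of_nonneg_right
    (Finset.sum_nonneg fun i _ => div_nonneg (mul_nonneg two_pos.le (hcP i)) (hδ i).le)
  have hPC : ∀ i x, x ⬝ᵥ (P i *ᵥ x) ≤ C * (x ⬝ᵥ (Q i *ᵥ x)) := by
    intro i x
    have hle : 2 * cP i / δ i ≤ C := by
      have := Finset.single_le_sum (f := fun i => 2 * cP i / δ i)
        (fun i _ => div_nonneg (mul_nonneg two_pos.le (hcP i)) (hδ i).le) (Finset.mem_univ i)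
      linarith
    have hQn := (SPsd.of (hQ i).posSemidef).2 x
    calc _ ≤ cP i * (x ⬝ᵥ x + x ⬝ᵥ x) := (le_abs_self _).trans (hcP' i x x)
      _ = (2 * cP i / δ i) * (δ i * (x ⬝ᵥ x)) := by
        have := (hδ i).ne'
        field_simp
        ring
      _ ≤ (2 * cP i / δ i) * (x ⬝ᵥ (Q i *ᵥ x)) :=
        mul_le_mul_of_nonneg_left (hδQ i x) (div_nonneg (mul_nonneg two_pos.le (hcP i)) (hδ i).le)
      _ ≤ _ := mul_le_mul_of_nonneg_right hle hQn
  set ρ : ℝ := 1 - C⁻¹ with hρ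
  have hCi : 0 < C⁻¹ := by positivity
  have hρ0 : 0 ≤ ρ := by
    have : C⁻¹ ≤ 1 := inv_le_one_of_one_le₀ hC1
    linarith
  have hρ1 : ρ < 1 := by linarith
  have hLP : ∀ i x, x ⬝ᵥ (opL Pr (Gam A B K) P i *ᵥ x) ≤ ρ * (x ⬝ᵥ (P i *ᵥ x)) := by
    intro i x
    have e1 := h1 i
    change P i = _ + opL Pr (Gam A B K) P i at e1
    have e2 : x ⬝ᵥ (P i *ᵥ x) = x ⬝ᵥ (Q i *ᵥ x) + (K i *ᵥ x) ⬝ᵥ (R i *ᵥ (K i *ᵥ x))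
        + x ⬝ᵥ (opL Pr (Gam A B K) P i *ᵥ x) := by
      nth_rewrite 1 [e1]
      rw [add_mulVec, add_mulVec, dotProduct_add, dotProduct_add, KRK_quad]
    have h3 : C⁻¹ * (x ⬝ᵥ (P i *ᵥ x)) ≤ x ⬝ᵥ (Q i *ᵥ x) := by
      rw [inv_mul_le_iff₀ (by positivity)]
      exact hPC i x
    have h4 := hRn i (K i *ᵥ x)
    rw [hρ, sub_mul, one_mul]
    linarith
  have hit : ∀ t : ℕ, ∀ i (x y : Fin d → ℝ),
      |x ⬝ᵥ ((opL Pr (Gam A B K))^[t] V i *ᵥ y)|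
        ≤ ρ ^ t * c * (x ⬝ᵥ (P i *ᵥ x) + y ⬝ᵥ (P i *ᵥ y)) := by
    intro t
    induction t with
    | zero => simpa using hVc
    | succ t ih =>
      intro i x y
      rw [Function.iterate_succ_apply', opL_bil]
      calc _ ≤ ∑ j, |Pr i j * _| := Finset.abs_sum_le_sum_abs _ _
        _ ≤ ∑ j, Pr i j * (ρ ^ t * c * _) := Finset.sum_le_sum fun j _ => by
            rw [abs_mul, abs_of_nonneg (hPr i j)]
            exact mul_le_mul_of_nonneg_left (ih j _ _) (hPr i j)
        _ = ρ ^ t * c * (x ⬝ᵥ (opL Pr (Gam A B K) P i *ᵥ x)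
              + y ⬝ᵥ (opL Pr (Gam A B K) P i *ᵥ y)) := by
            rw [opL_bil, opL_bil, ← Finset.sum_add_distrib, Finset.mul_sum]
            exact Finset.sum_congr rfl fun j _ => by ring
        _ ≤ ρ ^ t * c * (ρ * (x ⬝ᵥ (P i *ᵥ x)) + ρ * (y ⬝ᵥ (P i *ᵥ y))) :=
            mul_le_mul_of_nonneg_left (add_le_add (hLP i x) (hLP i y)) (by positivity)
        _ = _ := by ring
  have hz : Tendsto (fun t : ℕ => ρ ^ t * c * ((Pi.single a (1 : ℝ) : Fin d → ℝ) ⬝ᵥ (P i *ᵥ Pi.single a 1)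
      + (Pi.single b (1 : ℝ) : Fin d → ℝ) ⬝ᵥ (P i *ᵥ Pi.single b 1))) atTop (𝓝 0) := by
    have := ((tendsto_pow_atTop_nhds_zero_of_lt_one hρ0 hρ1).mul_const c).mul_const
      ((Pi.single a (1 : ℝ) : Fin d → ℝ) ⬝ᵥ (P i *ᵥ Pi.single a 1)
      + (Pi.single b (1 : ℝ) : Fin d → ℝ) ⬝ᵥ (P i *ᵥ Pi.single b 1))
    simpa using this
  refine squeeze_zero_norm (fun t => ?_) hz
  have := hit t i (Pi.single a 1) (Pi.single b 1)
  rw [mulVec_single_one (_ : Matrix _ _ ℝ) b, single_one_dotProduct] at this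
  simpa only [col_apply, Real.norm_eq_abs, mulVec_single_one] using this

end

lemma SPsd.diag_nonneg {d : ℕ} {M : Matrix (Fin d) (Fin d) ℝ} (h : SPsd M) (a : Fin d) :
    0 ≤ M a a := h.posSemidef.diag_nonneg

lemma SPsd.diag_le_trace {d : ℕ} {M : Matrix (Fin d) (Fin d) ℝ} (h : SPsd M) (a : Fin d) :
    M a a ≤ M.trace :=
  Finset.single_le_sum (f := fun a => M a a) (fun a _ => h.diag_nonneg a) (Finset.mem_univ a)

lemma SPsd.entry_le {d : ℕ} {M : Matrix (Fin d) (Fin d) ℝ} (h : SPsd M) (a b : Fin d) :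
    |M a b| ≤ M.trace := by
  have hs : M b a = M a b := congrFun (congrFun h.1 a) b
  have h1 := h.2 (Pi.single a 1 + Pi.single b 1)
  have h2 := h.2 (Pi.single a 1 - Pi.single b 1)
  simp only [mulVec_add, mulVec_sub, add_dotProduct, sub_dotProduct, dotProduct_add, dotProduct_sub,
    mulVec_single_one, single_one_dotProduct, col_apply] at h1 h2
  have h3 := h.diag_le_trace a
  have h4 := h.diag_le_trace b
  rw [abs_le]
  constructor <;> linarith

/-- compactness of the sublevel sets `𝕂_α`. -/
theorem sublevel_set_compact
    (d k N : ℕ) (hd : 0 < d) (hk : 0 < k) (hN : 0 < N)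
    (A : Fin N → Matrix (Fin d) (Fin d) ℝ) (B : Fin N → Matrix (Fin d) (Fin k) ℝ)
    (Pr : Matrix (Fin N) (Fin N) ℝ)
    (hPr : ∀ i j, 0 ≤ Pr i j) (hPrSum : ∀ i, ∑ j, Pr i j = 1)
    (piv : Fin N → ℝ) (hpiv : ∀ i, 0 < piv i) (hpivSum : ∑ i, piv i = 1)
    (Sg : Matrix (Fin d) (Fin d) ℝ) (hSg : Sg.PosDef)
    (Q : Fin N → Matrix (Fin d) (Fin d) ℝ) (hQ : ∀ i, (Q i).PosDef)
    (R : Fin N → Matrix (Fin k) (Fin k) ℝ) (hR : ∀ i, (R i).PosDef)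
    (α : ℝ) :
    IsCompact {K : Fin N → Matrix (Fin k) (Fin d) ℝ | MSS Pr A B K ∧ cost Pr A B Q R piv Sg K ≤ α} := by
  choose δR hδR hδR' using fun i => PosDef_lower (hR i)
  obtain ⟨δ, hδ, hδ'⟩ := PosDef_lower hSg
  have hPK : ∀ K, MSS Pr A B K → IsLyap Pr A B Q R K (PK Pr A B Q R K) := by
    intro K hK
    have hex : ∃ P, IsLyap Pr A B Q R K P := lyap_exists ((MSS_iff hd hN Pr A B K).1 hK)
    unfold PK
    rw [dif_pos hex]
    exact hex.choose_spec
  let S : Set ((Fin N → Matrix (Fin k) (Fin d) ℝ) × (Fin N → Matrix (Fin d) (Fin d) ℝ)) :=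
    {p | IsLyap Pr A B Q R p.1 p.2 ∧ (∀ i, SPsd (p.2 i)) ∧
      ∑ i, piv i * (p.2 i * Sg).trace ≤ α}
  have himg : {K : Fin N → Matrix (Fin k) (Fin d) ℝ |
      MSS Pr A B K ∧ cost Pr A B Q R piv Sg K ≤ α} = Prod.fst '' S := by
    ext K
    constructor
    · rintro ⟨hK, hc⟩
      exact ⟨(K, PK Pr A B Q R K), ⟨hPK K hK,
        lyap_psd hPr hQ hR ((MSS_iff hd hN Pr A B K).1 hK) (hPK K hK), hc⟩, rfl⟩
    · rintro ⟨⟨K', P⟩, ⟨h1, h2, h3⟩, rfl⟩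
      have hst := lyap_stable hPr hQ hR h2 h1
      have hM : MSS Pr A B K' := (MSS_iff hd hN Pr A B K').2 hst
      refine ⟨hM, ?_⟩
      have : PK Pr A B Q R K' = P := lyap_unique hst (hPK K' hM) h1
      unfold cost
      rw [this]
      exact h3
  rw [himg]
  refine IsCompact.image ?_ continuous_fst
  have hclosed : IsClosed S := by
    have c1 : IsClosed {p : (Fin N → Matrix (Fin k) (Fin d) ℝ) × (Fin N → Matrix (Fin d) (Fin d) ℝ) |
        IsLyap Pr A B Q R p.1 p.2} := by
      simp only [IsLyap, Set.ofPred_forall]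
      refine isClosed_iInter fun i => isClosed_eq (by fun_prop) ?_
      unfold Gam opE
      fun_prop
    have c2 : IsClosed {p : (Fin N → Matrix (Fin k) (Fin d) ℝ) × (Fin N → Matrix (Fin d) (Fin d) ℝ) |
        ∀ i, SPsd (p.2 i)} := by
      simp only [Set.ofPred_forall]
      refine isClosed_iInter fun i => ?_
      have hc : Continuous fun p : (Fin N → Matrix (Fin k) (Fin d) ℝ) ×
          (Fin N → Matrix (Fin d) (Fin d) ℝ) => p.2 i := by fun_prop
      exact (isClosed_SPsd (d := d)).preimage hc
    have c3 : IsClosed {p : (Fin N → Matrix (Fin k) (Fin d) ℝ) × (Fin N → Matrix (Fin d) (Fin d) ℝ) |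
        ∑ i, piv i * (p.2 i * Sg).trace ≤ α} :=
      isClosed_le (by fun_prop) (by fun_prop)
    exact c1.inter (c2.inter c3)
  -- bounds
  have htr : ∀ p ∈ S, ∀ i, (p.2 i).trace ≤ α / (piv i * δ) := by
    rintro ⟨K, P⟩ ⟨h1, h2, h3⟩ i
    have hnn : ∀ j, δ * (P j).trace ≤ (P j * Sg).trace := fun j => trace_lower (h2 j) hδ'
    have hn0 : ∀ j, 0 ≤ piv j * (P j * Sg).trace := fun j => mul_nonneg (hpiv j).le
      ((mul_nonneg hδ.le (h2 j).posSemidef.trace_nonneg).trans (hnn j))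
    have h4 : piv i * (P i * Sg).trace ≤ α := (Finset.single_le_sum
      (f := fun j => piv j * (P j * Sg).trace) (fun j _ => hn0 j) (Finset.mem_univ i)).trans h3
    rw [le_div_iff₀ (mul_pos (hpiv i) hδ)]
    have := mul_le_mul_of_nonneg_left (hnn i) (hpiv i).le
    simp only
    linarith
  have hKb : ∀ p ∈ S, ∀ i c a, |p.1 i c a| ≤ α / (piv i * δ) / δR i + 1 := by
    intro p hp i c a
    have ht := htr p hp i
    obtain ⟨h1, h2, h3⟩ := hp
    have h4 := lyap_lower hPr h2 h1 i (Pi.single a 1)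
    have hq := (SPsd.of (hQ i).posSemidef).2 (Pi.single a 1)
    have hr := hδR' i (p.1 i *ᵥ Pi.single a 1)
    have h5 : (Pi.single a 1 : Fin d → ℝ) ⬝ᵥ (p.2 i *ᵥ Pi.single a 1) ≤ (p.2 i).trace := by
      simpa only [mulVec_single_one, single_one_dotProduct, col_apply] using (h2 i).diag_le_trace a
    have h6 : p.1 i c a * p.1 i c a ≤
        (p.1 i *ᵥ Pi.single a 1) ⬝ᵥ (p.1 i *ᵥ Pi.single a 1) := by
      have := Finset.single_le_sum (f := fun c => p.1 i c a * p.1 i c a)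
        (fun c _ => mul_self_nonneg _) (Finset.mem_univ c)
      simpa only [mulVec_single_one, dotProduct, col_apply] using this
    have h7 : p.1 i c a * p.1 i c a ≤ α / (piv i * δ) / δR i := by
      rw [le_div_iff₀ (hδR i)]
      have := mul_le_mul_of_nonneg_left h6 (hδR i).le
      linarith
    rw [abs_le]
    constructor <;> nlinarith [sq_nonneg (p.1 i c a + 1), sq_nonneg (p.1 i c a - 1)]
  have hbox1 : IsCompact (Set.pi Set.univ fun i : Fin N => Set.pi Set.univ fun _ : Fin k =>
      Set.pi Set.univ fun _ : Fin d =>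
        Set.Icc (-(α / (piv i * δ) / δR i + 1)) (α / (piv i * δ) / δR i + 1)) :=
    isCompact_univ_pi fun i => isCompact_univ_pi fun _ => isCompact_univ_pi fun _ => isCompact_Icc
  have hbox2 : IsCompact (Set.pi Set.univ fun i : Fin N => Set.pi Set.univ fun _ : Fin d =>
      Set.pi Set.univ fun _ : Fin d =>
        Set.Icc (-(α / (piv i * δ))) (α / (piv i * δ))) :=
    isCompact_univ_pi fun i => isCompact_univ_pi fun _ => isCompact_univ_pi fun _ => isCompact_Icc
  refine IsCompact.of_isClosed_subset (hbox1.prod hbox2) hclosed ?_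
  intro p hp
  refine ⟨fun i _ c _ a _ => abs_le.1 (hKb p hp i c a), fun i _ a _ b _ => abs_le.1 ?_⟩
  exact ((hp.2.1 i).entry_le a b).trans (htr p hp i)

end MJLS
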